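/- Let λ and ρ be degree-distribution polynomials and let p ∈ (0,1] satisfy p·λ(1−ρ(1−x)) < x for all x ∈ (0,1] and p·λ′(0)·ρ′(1) < 1. Set α := sup_{x∈(0,1]} p·λ(1−ρ(1−x))/x (so α < 1), and define the coupled sequences x₀ = y₀ = 1, x_{i+1} = p·λ(1−ρ(1−x_i)), and y_{i+1} = λ(1−ρ(1−x_i)) + p·(ρ(1−x_i) − ρ(1−y_i))·λ′(1−ρ(1−x_i)). Then for every β with α < β < 1 there exists a constant C such that y_i ≤ C·β^i for all i; i.e., y_i eventually decreases exponentially at a rate arbitrarily close to α. -/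

import Mathlib

lemma aux_mono (q : Polynomial ℝ) (hq : ∀ n, 0 ≤ q.coeff n) {a b : ℝ} (ha : 0 ≤ a)
    (hab : a ≤ b) : q.eval a ≤ q.eval b := by
  rw [Polynomial.eval_eq_sum_range, Polynomial.eval_eq_sum_range]
  exact Finset.sum_le_sum fun i _ =>
    mul_le_mul_of_nonneg_left (pow_le_pow_left₀ ha hab i) (hq i)

lemma aux_nonneg (q : Polynomial ℝ) (hq : ∀ n, 0 ≤ q.coeff n) {a : ℝ} (ha : 0 ≤ a) :
    0 ≤ q.eval a := by
  rw [Polynomial.eval_eq_sum_range]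
  exact Finset.sum_nonneg fun i _ => mul_nonneg (hq i) (pow_nonneg ha i)

lemma aux_deriv (q : Polynomial ℝ) (hq : ∀ n, 0 ≤ q.coeff n) :
    ∀ n, 0 ≤ q.derivative.coeff n := by
  intro n
  rw [Polynomial.coeff_derivative]
  exact mul_nonneg (hq _) (by positivity)

lemma aux_mvt (q : Polynomial ℝ) (hq : ∀ n, 0 ≤ q.coeff n) {a b : ℝ} (ha : 0 ≤ a)
    (hab : a ≤ b) : q.derivative.eval a * (b - a) ≤ q.eval b - q.eval a ∧
      q.eval b - q.eval a ≤ q.derivative.eval b * (b - a) := by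
  rcases hab.eq_or_lt with rfl | h
  · simp
  obtain ⟨c, hc, he⟩ := exists_hasDerivAt_eq_slope (fun t => q.eval t)
    (fun t => q.derivative.eval t) h q.continuous.continuousOn (fun t _ => q.hasDerivAt t)
  have hba : 0 < b - a := by linarith
  rw [eq_div_iff hba.ne'] at he
  rw [← he]
  have hd := aux_deriv q hq
  exact ⟨mul_le_mul_of_nonneg_right (aux_mono _ hd ha hc.1.le) hba.le,
    mul_le_mul_of_nonneg_right (aux_mono _ hd (ha.trans hc.1.le) hc.2.le) hba.le⟩

/-- Below threshold and under the stability condition, with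
`α = sup_{x ∈ (0,1]} p·λ(1-ρ(1-x))/x < 1`, the unverified-message probability
`y_i` decays exponentially at any rate `β` with `α < β < 1`:
there is a constant `C` with `y_i ≤ C·β^i` for all `i`. -/
theorem de_y_exponential_decay
    (lam rho : Polynomial ℝ)
    (hlam_nonneg : ∀ n, 0 ≤ lam.coeff n)
    (hrho_nonneg : ∀ n, 0 ≤ rho.coeff n)
    (hlam0 : lam.eval 0 = 0) (hlam1 : lam.eval 1 = 1)
    (hrho0 : rho.eval 0 = 0) (hrho1 : rho.eval 1 = 1)
    (p : ℝ) (hp : p ∈ Set.Ioc (0:ℝ) 1)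
    (hthresh : ∀ t ∈ Set.Ioc (0:ℝ) 1, p * lam.eval (1 - rho.eval (1 - t)) < t)
    (hstab : p * lam.derivative.eval 0 * rho.derivative.eval 1 < 1)
    (α : ℝ)
    (hα : α = sSup ((fun t => p * lam.eval (1 - rho.eval (1 - t)) / t) ''
      Set.Ioc (0:ℝ) 1))
    (x y : ℕ → ℝ) (hx0 : x 0 = 1) (hy0 : y 0 = 1)
    (hx : ∀ i, x (i + 1) = p * lam.eval (1 - rho.eval (1 - x i)))
    (hy : ∀ i, y (i + 1) =
      lam.eval (1 - rho.eval (1 - x i))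
        + p * (rho.eval (1 - x i) - rho.eval (1 - y i))
            * lam.derivative.eval (1 - rho.eval (1 - x i))) :
    ∀ β : ℝ, α < β → β < 1 → ∃ C : ℝ, ∀ i, y i ≤ C * β ^ i := by
  intro β hαβ hβ1
  obtain ⟨hp0, hp1⟩ := hp
  have hub : ∀ t ∈ Set.Ioc (0:ℝ) 1, p * lam.eval (1 - rho.eval (1 - t)) / t ≤ α := by
    intro t ht
    rw [hα]
    refine le_csSup ⟨1, ?_⟩ ⟨t, ht, rfl⟩
    rintro _ ⟨s, hs, rfl⟩
    exact (div_le_one hs.1).2 (hthresh s hs).le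
  have hα0 : 0 < α := by
    have := hub 1 (by simp)
    simp [hrho0, hlam1] at this
    linarith
  have hβ0 : 0 < β := hα0.trans hαβ
  -- the slope at zero
  have hslope : p * lam.derivative.eval 0 * rho.derivative.eval 1 ≤ α := by
    have h1 : HasDerivAt (fun t : ℝ => rho.eval (1 - t)) (rho.derivative.eval 1 * (-1)) 0 := by
      have hr : HasDerivAt (fun t => rho.eval t) (rho.derivative.eval 1) (1 - 0) := by
        simpa using rho.hasDerivAt (1:ℝ)
      exact hr.comp 0 ((hasDerivAt_id (0:ℝ)).const_sub 1)
    have h2 : HasDerivAt (fun t : ℝ => 1 - rho.eval (1 - t)) (rho.derivative.eval 1) 0 := by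
      simpa using h1.const_sub 1
    have h3 : HasDerivAt (fun t : ℝ => p * lam.eval (1 - rho.eval (1 - t)))
        (p * (lam.derivative.eval 0 * rho.derivative.eval 1)) 0 := by
      have hl : HasDerivAt (fun t => lam.eval t) (lam.derivative.eval 0)
          (1 - rho.eval (1 - 0)) := by
        simpa [hrho1] using lam.hasDerivAt (0:ℝ)
      exact (hl.comp (0:ℝ) h2).const_mul p
    have h4 := h3.tendsto_slope_zero_right
    rw [mul_assoc]
    refine le_of_tendsto h4 ?_
    filter_upwards [Ioc_mem_nhdsGT (zero_lt_one : (0:ℝ) < 1)] with t ht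
    have := hub t ht
    simpa [hrho1, hlam0, div_eq_inv_mul] using this
  have hρ01 : ∀ t, 0 ≤ t → t ≤ 1 → 0 ≤ rho.eval (1 - t) ∧ rho.eval (1 - t) ≤ 1 := by
    intro t h0 h1
    refine ⟨aux_nonneg _ hrho_nonneg (by linarith), ?_⟩
    rw [← hrho1]
    exact aux_mono _ hrho_nonneg (by linarith) (by linarith)
  have hx01 : ∀ i, 0 ≤ x i ∧ x i ≤ 1 ∧ x i ≤ α ^ i := by
    intro i
    induction i with
    | zero => simp [hx0]
    | succ i ih =>
      obtain ⟨h0, h1, h2⟩ := ih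
      obtain ⟨r0, r1⟩ := hρ01 _ h0 h1
      have hn : 0 ≤ x (i+1) := by
        rw [hx]
        exact mul_nonneg hp0.le (aux_nonneg _ hlam_nonneg (by linarith))
      have hle : x (i+1) ≤ α * x i := by
        rcases h0.eq_or_lt with h | h
        · rw [hx, ← h]; simp [hrho1, hlam0]
        · rw [hx]
          exact (div_le_iff₀ h).1 (hub _ ⟨h, h1⟩)
      refine ⟨hn, ?_, ?_⟩
      · nlinarith
      · rw [pow_succ']
        exact hle.trans (mul_le_mul_of_nonneg_left h2 hα0.le)
  have hy01 : ∀ i, x i ≤ y i ∧ y i ≤ 1 := by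
    intro i
    induction i with
    | zero => simp [hx0, hy0]
    | succ i ih =>
      obtain ⟨h0, h1, h2⟩ := hx01 i
      obtain ⟨k0, k1⟩ := ih
      obtain ⟨r0, r1⟩ := hρ01 _ h0 h1
      obtain ⟨s0, s1⟩ := hρ01 _ (h0.trans k0) k1
      have hmono : rho.eval (1 - y i) ≤ rho.eval (1 - x i) :=
        aux_mono _ hrho_nonneg (by linarith) (by linarith)
      have hl0 : 0 ≤ lam.eval (1 - rho.eval (1 - x i)) :=
        aux_nonneg _ hlam_nonneg (by linarith)
      have hd0 : 0 ≤ lam.derivative.eval (1 - rho.eval (1 - x i)) :=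
        aux_nonneg _ (aux_deriv _ hlam_nonneg) (by linarith)
      have hprod : 0 ≤ (rho.eval (1 - x i) - rho.eval (1 - y i))
            * lam.derivative.eval (1 - rho.eval (1 - x i)) :=
        mul_nonneg (by linarith) hd0
      have hm := (aux_mvt lam hlam_nonneg (a := 1 - rho.eval (1 - x i))
        (b := 1 - rho.eval (1 - y i)) (by linarith) (by linarith)).1
      have hv : lam.eval (1 - rho.eval (1 - y i)) ≤ 1 := by
        exact (aux_mono _ hlam_nonneg (by linarith) (by linarith)).trans_eq hlam1
      rw [hx, hy, mul_assoc p]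
      constructor
      · nlinarith
      · nlinarith
  obtain ⟨γ, hαγ, hγβ⟩ := exists_between hαβ
  have hxlim : Filter.Tendsto x Filter.atTop (nhds 0) :=
    squeeze_zero (fun i => (hx01 i).1) (fun i => (hx01 i).2.2)
      (tendsto_pow_atTop_nhds_zero_of_lt_one hα0.le (hαβ.trans hβ1))
  have hclim : Filter.Tendsto (fun i => p * lam.derivative.eval (1 - rho.eval (1 - x i))
      * rho.derivative.eval 1) Filter.atTop
      (nhds (p * lam.derivative.eval 0 * rho.derivative.eval 1)) := by
    have hc : Continuous (fun t : ℝ => p * lam.derivative.eval (1 - rho.eval (1 - t))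
      * rho.derivative.eval 1) := by fun_prop
    have := (hc.tendsto 0).comp hxlim
    simpa [hrho1, Function.comp_def] using this
  obtain ⟨N, hN⟩ := Filter.eventually_atTop.1
    (hclim.eventually_lt_const (hslope.trans_lt hαγ))
  have hstep : ∀ i, N ≤ i → y (i+1) ≤ β ^ (i+1) / p + γ * y i := by
    intro i hi
    obtain ⟨h0, h1, h2⟩ := hx01 i
    obtain ⟨k0, k1⟩ := hy01 i
    obtain ⟨r0, r1⟩ := hρ01 _ h0 h1
    have hd0 : 0 ≤ lam.derivative.eval (1 - rho.eval (1 - x i)) :=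
      aux_nonneg _ (aux_deriv _ hlam_nonneg) (by linarith)
    have hr0 : 0 ≤ rho.derivative.eval 1 :=
      aux_nonneg _ (aux_deriv _ hrho_nonneg) (by linarith)
    have hm := (aux_mvt rho hrho_nonneg (a := 1 - y i) (b := 1 - x i)
      (by linarith) (by linarith)).2
    have hdm : rho.derivative.eval (1 - x i) ≤ rho.derivative.eval 1 :=
      aux_mono _ (aux_deriv _ hrho_nonneg) (by linarith) (by linarith)
    have hm2 : rho.eval (1 - x i) - rho.eval (1 - y i) ≤ rho.derivative.eval 1 * y i := by
      have e1 : rho.derivative.eval (1 - x i) * (1 - x i - (1 - y i))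
          ≤ rho.derivative.eval 1 * (1 - x i - (1 - y i)) :=
        mul_le_mul_of_nonneg_right hdm (by linarith)
      have e2 : rho.derivative.eval 1 * (1 - x i - (1 - y i)) ≤ rho.derivative.eval 1 * y i :=
        mul_le_mul_of_nonneg_left (by linarith) hr0
      linarith
    have hfirst : lam.eval (1 - rho.eval (1 - x i)) ≤ β ^ (i+1) / p := by
      rw [le_div_iff₀ hp0, mul_comm, ← hx]
      exact (hx01 (i+1)).2.2.trans (pow_le_pow_left₀ hα0.le hαβ.le _)
    have hsecond : p * (rho.eval (1 - x i) - rho.eval (1 - y i))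
            * lam.derivative.eval (1 - rho.eval (1 - x i)) ≤ γ * y i := by
      calc _ ≤ p * (rho.derivative.eval 1 * y i)
            * lam.derivative.eval (1 - rho.eval (1 - x i)) := by gcongr
        _ = (p * lam.derivative.eval (1 - rho.eval (1 - x i))
              * rho.derivative.eval 1) * y i := by ring
        _ ≤ γ * y i := mul_le_mul_of_nonneg_right (hN i hi).le (h0.trans k0)
    rw [hy]
    linarith
  have hβγ : 0 < β - γ := by linarith
  have hγ0 : 0 < γ := hα0.trans hαγ
  refine ⟨max ((β ^ N)⁻¹) (β / (p * (β - γ))), ?_⟩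
  set C := max ((β ^ N)⁻¹) (β / (p * (β - γ))) with hC
  have hC1 : (β ^ N)⁻¹ ≤ C := le_max_left _ _
  have hC2 : β / p ≤ C * (β - γ) := by
    have : β / (p * (β - γ)) ≤ C := le_max_right _ _
    rw [← div_div, div_le_iff₀ hβγ] at this
    exact this
  have hsmall : ∀ i, i ≤ N → y i ≤ C * β ^ i := by
    intro i hi
    refine (hy01 i).2.trans ?_
    have e1 : β ^ N ≤ β ^ i := pow_le_pow_of_le_one hβ0.le hβ1.le hi
    have hpos : 0 < β ^ N := pow_pos hβ0 N
    calc (1:ℝ) = (β ^ N)⁻¹ * β ^ N := (inv_mul_cancel₀ hpos.ne').symm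
      _ ≤ C * β ^ i := mul_le_mul hC1 e1 hpos.le ((inv_pos.2 hpos).le.trans hC1)
  intro i
  rcases le_total i N with hi | hi
  · exact hsmall i hi
  induction i, hi using Nat.le_induction with
  | base => exact hsmall N le_rfl
  | succ i hi ih =>
    have h := hstep i hi
    have e1 : γ * y i ≤ γ * (C * β ^ i) := mul_le_mul_of_nonneg_left ih hγ0.le
    have e2 : β / p * β ^ i ≤ C * (β - γ) * β ^ i :=
      mul_le_mul_of_nonneg_right hC2 (pow_pos hβ0 i).le
    have e3 : β ^ (i+1) / p = β / p * β ^ i := by rw [pow_succ]; ring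
    rw [e3] at h
    rw [pow_succ]
    linarith
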